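/- For every integer D ≥ 2, there exists ε > 0 such that for all complex numbers g_1, …, g_D with |g_i| < ε for each i, and for every integer n ≥ 0, the sums F_n(g_1,…,g_D) = ∑_{(p_1,…,p_D) ∈ ℕ^D} C^n_{p_1…p_D} ∏_i g_i^{p_i} satisfy F_n(g_1,…,g_D) = (F_1(g_1,…,g_D))^n; i.e., the sequence (F_n) is geometric with common ratio F_1. -/

import Mathlib

/-- The complex number `Cⁿ_{p₁…p_D}`: for `n ≥ 1` this is
`(n/(p₁+⋯+p_D+n)) · ∏_j binom(p₁+⋯+p_D+n, p_j)`; for `n = 0` it is `1` if all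
`p_i = 0` and `0` otherwise. -/
noncomputable def Ccoef (D n : ℕ) (p : Fin D → ℕ) : ℂ :=
  if n = 0 then (if ∀ i, p i = 0 then 1 else 0)
  else (n : ℂ) / ((∑ i, p i : ℕ) + n) * ∏ j, ((∑ i, p i + n).choose (p j) : ℂ)

/-- `F D n g = ∑_{(p₁,…,p_D) ∈ ℕ^D} Cⁿ_{p₁…p_D} ∏_i g_iᵖⁱ`. -/
noncomputable def F (D n : ℕ) (g : Fin D → ℂ) : ℂ :=
  ∑' p : Fin D → ℕ, Ccoef D n p * ∏ i, g i ^ p i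

open PowerSeries in
/-- Lagrange coefficients. -/
noncomputable def lagA (φ : PowerSeries ℂ) (n m : ℕ) : ℂ :=
  if n = 0 then (if m = 0 then 1 else 0)
  else (n : ℂ) / ((m : ℂ) + n) * PowerSeries.coeff m (φ ^ (m + n))

lemma lagA_zero_left (φ : PowerSeries ℂ) (m : ℕ) : lagA φ 0 m = if m = 0 then 1 else 0 := by
  simp [lagA]

lemma lagA_pos (φ : PowerSeries ℂ) {n m : ℕ} (h : 0 < m + n) :
    lagA φ n m = (n : ℂ) / ((m : ℂ) + n) * PowerSeries.coeff m (φ ^ (m + n)) := by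
  unfold lagA
  by_cases hn : n = 0
  · subst hn
    have : m ≠ 0 := by omega
    simp [this]
  · simp [hn]

lemma coeff_X_mul_deriv (f : PowerSeries ℂ) (j : ℕ) :
    PowerSeries.coeff j (PowerSeries.X * PowerSeries.derivative ℂ f) =
      (j : ℂ) * PowerSeries.coeff j f := by
  cases j with
  | zero => simp
  | succ j =>
    rw [PowerSeries.coeff_succ_X_mul, PowerSeries.coeff_derivative]
    push_cast; ring

lemma lagA_rec (φ : PowerSeries ℂ) (h0 : PowerSeries.constantCoeff φ = 1) (n m : ℕ) :
    lagA φ (n + 1) m = ∑ x ∈ Finset.HasAntidiagonal.antidiagonal m,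
      PowerSeries.coeff x.1 φ * lagA φ (n + x.1) x.2 := by
  rcases Nat.eq_zero_or_pos (m + n) with h | h
  · obtain ⟨rfl, rfl⟩ : m = 0 ∧ n = 0 := by omega
    simp [lagA, h0]
  · have hN : ((m : ℂ) + n) ≠ 0 := by exact_mod_cast h.ne'
    have hN1 : ((m : ℂ) + n + 1) ≠ 0 := by exact_mod_cast (Nat.succ_ne_zero (m + n))
    have e1 : ∑ x ∈ Finset.HasAntidiagonal.antidiagonal m,
        PowerSeries.coeff x.1 φ * lagA φ (n + x.1) x.2 =
        1 / ((m : ℂ) + n) * PowerSeries.coeff m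
          ((((n : ℕ) : PowerSeries ℂ) * φ + PowerSeries.X * PowerSeries.derivative ℂ φ)
            * φ ^ (m + n)) := by
      rw [PowerSeries.coeff_mul, Finset.mul_sum]
      refine Finset.sum_congr rfl fun x hx => ?_
      have hx := Finset.HasAntidiagonal.mem_antidiagonal.1 hx
      rw [lagA_pos φ (by omega), map_add, coeff_X_mul_deriv]
      have e2 : x.2 + (n + x.1) = m + n := by omega
      have e3 : ((x.2 : ℂ) + ((n + x.1 : ℕ) : ℂ)) = m + n := by exact_mod_cast e2
      have e4 : PowerSeries.coeff x.1 (((n : ℕ) : PowerSeries ℂ) * φ)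
          = (n : ℂ) * PowerSeries.coeff x.1 φ := by
        rw [← nsmul_eq_mul, map_nsmul, nsmul_eq_mul]
      rw [e2, e3, e4]
      push_cast; ring
    have e5 : PowerSeries.coeff m (PowerSeries.X * PowerSeries.derivative ℂ φ * φ ^ (m + n))
        * ((m : ℂ) + n + 1) = m * PowerSeries.coeff m (φ ^ (m + n + 1)) := by
      rw [← coeff_X_mul_deriv, PowerSeries.derivative_pow]
      have : PowerSeries.X * (((m + n + 1 : ℕ) : PowerSeries ℂ) * φ ^ (m + n + 1 - 1)
          * PowerSeries.derivative ℂ φ) =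
          (m + n + 1 : ℕ) • (PowerSeries.X * PowerSeries.derivative ℂ φ * φ ^ (m + n)) := by
        rw [nsmul_eq_mul, Nat.add_sub_cancel]; ring
      rw [this, map_nsmul, nsmul_eq_mul]
      push_cast; ring
    have e6 : PowerSeries.coeff m (((n : ℕ) : PowerSeries ℂ) * φ * φ ^ (m + n))
        = n * PowerSeries.coeff m (φ ^ (m + n + 1)) := by
      rw [mul_assoc, ← nsmul_eq_mul, map_nsmul, nsmul_eq_mul, pow_succ']
    rw [e1, add_mul, map_add, e6, lagA_pos φ (by omega), eq_div_of_mul_eq hN1 e5,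
      show m + (n + 1) = m + n + 1 by ring]
    push_cast
    rw [← add_assoc]
    field_simp
    ring

lemma lagA_conv (φ : PowerSeries ℂ) (h0 : PowerSeries.constantCoeff φ = 1) (l : ℕ) (m : ℕ) :
    ∀ n, ∑ x ∈ Finset.HasAntidiagonal.antidiagonal m, lagA φ n x.1 * lagA φ l x.2 = lagA φ (n + l) m := by
  induction m using Nat.strong_induction_on with
  | _ m ihm =>
  intro n
  induction n with
  | zero =>
    rw [Finset.sum_eq_single (0, m)]
    · simp [lagA_zero_left]
    · rintro ⟨a, b⟩ hx hne
      have hx := Finset.HasAntidiagonal.mem_antidiagonal.1 hx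
      have : a ≠ 0 := by
        rintro rfl
        apply hne
        simp at hx
        simp [hx]
      simp [lagA_zero_left, this]
    · simp
  | succ n ihn =>
    have e1 : ∑ x ∈ Finset.HasAntidiagonal.antidiagonal m, lagA φ (n + 1) x.1 * lagA φ l x.2 =
        ∑ x ∈ Finset.HasAntidiagonal.antidiagonal m, PowerSeries.coeff x.1 φ *
          ∑ y ∈ Finset.HasAntidiagonal.antidiagonal x.2, lagA φ (n + x.1) y.1 * lagA φ l y.2 := by
      simp_rw [lagA_rec φ h0 n, Finset.sum_mul, Finset.mul_sum]
      rw [Finset.sum_sigma', Finset.sum_sigma']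
      refine Finset.sum_nbij' (fun x => ⟨(x.2.1, x.2.2 + x.1.2), (x.2.2, x.1.2)⟩)
        (fun x => ⟨(x.1.1 + x.2.1, x.2.2), (x.1.1, x.2.1)⟩) ?_ ?_ ?_ ?_ ?_
      · rintro ⟨⟨a, b⟩, ⟨c, d⟩⟩ hx
        simp at hx ⊢; omega
      · rintro ⟨⟨a, b⟩, ⟨c, d⟩⟩ hx
        simp at hx ⊢; omega
      · rintro ⟨⟨a, b⟩, ⟨c, d⟩⟩ hx
        simp at hx ⊢; omega
      · rintro ⟨⟨a, b⟩, ⟨c, d⟩⟩ hx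
        simp at hx ⊢; omega
      · rintro ⟨⟨a, b⟩, ⟨c, d⟩⟩ hx
        simp only; ring
    rw [e1, show n + 1 + l = n + l + 1 by ring, lagA_rec φ h0 (n + l) m]
    refine Finset.sum_congr rfl fun x hx => ?_
    have hx := Finset.HasAntidiagonal.mem_antidiagonal.1 hx
    rw [show n + l + x.1 = n + x.1 + l by ring]
    congr 1
    rcases Nat.eq_zero_or_pos x.1 with h | h
    · have h2 : x.2 = m := by omega
      rw [h, h2]; exact ihn
    · exact ihm _ (by omega) _

lemma summable_prod_geom (D : ℕ) (r : Fin D → ℝ) (h0 : ∀ i, 0 ≤ r i) (h1 : ∀ i, r i < 1) :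
    Summable (fun p : Fin D → ℕ => ∏ i, r i ^ p i) := by
  induction D with
  | zero => exact (hasSum_fintype _).summable
  | succ D ih =>
    rw [← (Fin.consEquiv (fun _ : Fin (D + 1) => ℕ)).summable_iff]
    have := Summable.mul_of_nonneg (summable_geometric_of_lt_one (h0 0) (h1 0))
      (ih (fun i => r i.succ) (fun i => h0 _) (fun i => h1 _))
      (fun k => pow_nonneg (h0 0) k)
      (fun p => Finset.prod_nonneg fun i _ => pow_nonneg (h0 _) _)
    refine this.congr fun x => ?_
    simp [Fin.prod_univ_succ, Fin.consEquiv]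

lemma norm_Ccoef_le (D n : ℕ) (p : Fin D → ℕ) :
    ‖Ccoef D n p‖ ≤ ((2 : ℝ) ^ D) ^ n * ∏ i, ((2 : ℝ) ^ D) ^ p i := by
  have hb : ((2 : ℝ) ^ D) ^ n * ∏ i, ((2 : ℝ) ^ D) ^ p i = ((2 : ℝ) ^ (∑ i, p i + n)) ^ D := by
    rw [Finset.prod_pow_eq_pow_sum, ← pow_add, ← pow_mul, ← pow_mul]
    congr 1; ring
  rw [hb]
  have h1 : (1 : ℝ) ≤ ((2 : ℝ) ^ (∑ i, p i + n)) ^ D :=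
    one_le_pow₀ (one_le_pow₀ (by norm_num))
  unfold Ccoef
  split_ifs with h h'
  · simpa using h1
  · simp
  · rw [norm_mul, norm_prod]
    have a1 : ‖(n : ℂ) / ((∑ i, p i : ℕ) + n)‖ ≤ 1 := by
      have : ((∑ i, p i : ℕ) + n : ℂ) = ((∑ i, p i + n : ℕ) : ℂ) := by push_cast; rfl
      rw [this, norm_div, Complex.norm_natCast, Complex.norm_natCast]
      apply div_le_one_of_le₀ _ (by positivity)
      exact_mod_cast Nat.le_add_left _ _
    have a2 : ∏ j, ‖((∑ i, p i + n).choose (p j) : ℂ)‖ ≤ ((2 : ℝ) ^ (∑ i, p i + n)) ^ D := by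
      calc _ ≤ ∏ j : Fin D, (2 : ℝ) ^ (∑ i, p i + n) := by
            refine Finset.prod_le_prod (fun _ _ => norm_nonneg _) fun j _ => ?_
            rw [Complex.norm_natCast]
            exact_mod_cast Nat.choose_le_two_pow _ _
        _ = _ := by simp
    calc _ ≤ 1 * ((2 : ℝ) ^ (∑ i, p i + n)) ^ D :=
          mul_le_mul a1 a2 (Finset.prod_nonneg fun _ _ => norm_nonneg _) zero_le_one
      _ = _ := one_mul _

lemma summable_F (D n : ℕ) (g : Fin D → ℂ) (hg : ∀ i, ‖g i‖ < (1 / 2) ^ D) :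
    Summable (fun p : Fin D → ℕ => Ccoef D n p * ∏ i, g i ^ p i) := by
  have h1 := (summable_prod_geom D (fun i => 2 ^ D * ‖g i‖) (fun i => by positivity) (fun i => by
    have := hg i
    calc (2 : ℝ) ^ D * ‖g i‖ < 2 ^ D * (1 / 2) ^ D := by gcongr
      _ = 1 := by rw [← mul_pow]; norm_num)).mul_left (((2 : ℝ) ^ D) ^ n)
  refine Summable.of_norm_bounded h1 fun p => ?_
  rw [norm_mul, norm_prod]
  simp_rw [mul_pow, norm_pow]
  rw [Finset.prod_mul_distrib, ← mul_assoc]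
  exact mul_le_mul_of_nonneg_right (norm_Ccoef_le D n p)
    (Finset.prod_nonneg fun _ _ => by positivity)

/-- The polynomial `∏ (1 + g_j X)`. -/
noncomputable def phiG (D : ℕ) (g : Fin D → ℂ) : PowerSeries ℂ :=
  ∏ j, PowerSeries.rescale (g j) (1 + PowerSeries.X)

lemma phiG_const (D : ℕ) (g : Fin D → ℂ) : PowerSeries.constantCoeff (phiG D g) = 1 := by
  rw [phiG, map_prod]
  refine Finset.prod_eq_one fun j _ => ?_
  rw [← PowerSeries.coeff_zero_eq_constantCoeff_apply, PowerSeries.coeff_rescale]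
  simp

lemma coeff_phiG_pow (D : ℕ) (g : Fin D → ℂ) (N m : ℕ) :
    PowerSeries.coeff m (phiG D g ^ N) = ∑ p ∈ Finset.piAntidiag Finset.univ m,
      (∏ j, (N.choose (p j) : ℂ)) * ∏ i, g i ^ p i := by
  have hc : ∀ k, PowerSeries.coeff k ((1 + PowerSeries.X : PowerSeries ℂ) ^ N)
      = (N.choose k : ℂ) := fun k => by
    rw [← Polynomial.coeff_one_add_X_pow ℂ N k, ← Polynomial.coeff_coe]
    simp
  rw [phiG, ← Finset.prod_pow, PowerSeries.coeff_prod]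
  refine Finset.sum_nbij' (fun l => (l : Fin D → ℕ)) (fun p => Finsupp.equivFunOnFinite.symm p)
    ?_ ?_ ?_ ?_ ?_
  · intro l hl
    simp at hl ⊢
    exact hl
  · intro l hl
    simp at hl ⊢
    exact hl
  · intro l hl
    ext; simp
  · intro l hl
    ext; simp
  · intro l hl
    rw [← Finset.prod_mul_distrib]
    refine Finset.prod_congr rfl fun i _ => ?_
    rw [← map_pow, PowerSeries.coeff_rescale, hc, mul_comm]

lemma lagA_phiG (D n : ℕ) (g : Fin D → ℂ) (m : ℕ) :
    lagA (phiG D g) n m = ∑ p ∈ Finset.piAntidiag Finset.univ m,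
      Ccoef D n p * ∏ i, g i ^ p i := by
  by_cases hn : n = 0
  · subst hn
    by_cases hm : m = 0
    · subst hm
      simp [lagA, Ccoef]
    · rw [lagA_zero_left, if_neg hm, Finset.sum_eq_zero]
      intro p hp
      have hp := (Finset.mem_piAntidiag.1 hp).1
      have : ¬ ∀ i, p i = 0 := fun h => hm (by rw [← hp]; simp [h])
      simp [Ccoef, this]
  · rw [lagA, if_neg hn, coeff_phiG_pow, Finset.mul_sum]
    refine Finset.sum_congr rfl fun p hp => ?_
    have hp := (Finset.mem_piAntidiag.1 hp).1
    rw [Ccoef, if_neg hn, hp, mul_assoc]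

lemma hasSum_lagA (D n : ℕ) (g : Fin D → ℂ) (hg : ∀ i, ‖g i‖ < (1 / 2) ^ D) :
    HasSum (lagA (phiG D g) n) (F D n g) := by
  have h := (summable_F D n g hg).hasSum.tsum_fiberwise (fun p : Fin D → ℕ => ∑ i, p i)
  suffices key : lagA (phiG D g) n = fun m => ∑' b : ((fun p : Fin D → ℕ => ∑ i, p i) ⁻¹' {m}),
      Ccoef D n b * ∏ i, g i ^ (b : Fin D → ℕ) i from by
    rw [key]; exact h
  funext m
  rw [lagA_phiG, ← Finset.tsum_subtype]
  have : (fun p : Fin D → ℕ => ∑ i, p i) ⁻¹' {m}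
      = {p | p ∈ Finset.piAntidiag (Finset.univ : Finset (Fin D)) m} := by
    ext p; simp
  rw [this]
  rfl

theorem Fn_is_geometric (D : ℕ) (hD : 2 ≤ D) :
    ∃ ε > 0, ∀ g : Fin D → ℂ, (∀ i, ‖g i‖ < ε) →
      ∀ n : ℕ, F D n g = F D 1 g ^ n := by
  refine ⟨(1 / 2) ^ D, by positivity, fun g hg n => ?_⟩
  induction n with
  | zero =>
    rw [pow_zero, ← (hasSum_lagA D 0 g hg).tsum_eq, tsum_eq_single 0]
    · simp [lagA]
    · intro m hm
      simp [lagA, hm]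
  | succ n ih =>
    rw [pow_succ, ← ih, ← (hasSum_lagA D n g hg).tsum_eq, ← (hasSum_lagA D 1 g hg).tsum_eq,
      ← (hasSum_lagA D (n + 1) g hg).tsum_eq,
      tsum_mul_tsum_eq_tsum_sum_antidiagonal_of_summable_norm
        (hasSum_lagA D n g hg).summable.norm (hasSum_lagA D 1 g hg).summable.norm]
    exact tsum_congr fun m => (lagA_conv _ (phiG_const D g) 1 m n).symm
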